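/- Let a ∈ A be an axis of Jordan type (λ,δ) with λ ≠ δ, and let b ∈ A be an axis of type (λ',δ') for some λ',δ' ∈ F \ {0,1}. Write b = α_b·a + b_0 + b_{λ,δ} with α_b ∈ F, b_0 ∈ A_{0,0}(a), b_{λ,δ} ∈ A_{λ,δ}(a). Then b_{λ,δ}·b_{λ,δ} = 0. -/

import Mathlib

/-! Common definitions: eigenspaces of left/right multiplication, axes, Jordan axes,
in a not-necessarily-associative, not-necessarily-commutative, not-necessarily-unital
algebra `A` over a field `F`. -/

variable (F : Type*) [Field F]
variable (A : Type*) [NonUnitalNonAssocRing A] [Module F A]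
  [SMulCommClass F A A] [IsScalarTower F A A]

/-- `leftEig F A a l = A_l(L_a) = {v : A | a * v = l • v}`, as a submodule of `A`. -/
def leftEig (a : A) (l : F) : Submodule F A where
  carrier := {v | a * v = l • v}
  add_mem' := by
    intro x y hx hy
    simp only [Set.mem_setOf_eq] at *
    rw [mul_add, hx, hy, smul_add]
  zero_mem' := by simp
  smul_mem' := by
    intro c x hx
    simp only [Set.mem_setOf_eq] at *
    rw [mul_smul_comm, hx, smul_comm]

/-- `rightEig F A a l = A_l(R_a) = {v : A | v * a = l • v}`, as a submodule of `A`. -/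
def rightEig (a : A) (l : F) : Submodule F A where
  carrier := {v | v * a = l • v}
  add_mem' := by
    intro x y hx hy
    simp only [Set.mem_setOf_eq] at *
    rw [add_mul, hx, hy, smul_add]
  zero_mem' := by simp
  smul_mem' := by
    intro c x hx
    simp only [Set.mem_setOf_eq] at *
    rw [smul_mul_assoc, hx, smul_comm]

/-- `eig2 F A a l d = A_{l,d}(a) = A_l(L_a) ⊓ A_d(R_a)`. -/
def eig2 (a : A) (l d : F) : Submodule F A :=
  leftEig F A a l ⊓ rightEig F A a d

/-- `a` is a left axis of type `l` (with `l ∉ {0,1}`):  an absolutely primitive idempotent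
whose left multiplication operator satisfies `(L_a - l)(L_a - 1)L_a = 0`, such that the
eigenspace decomposition `A = A_0(L_a) ⊕ A_1(L_a) ⊕ A_l(L_a)` is a ℤ/2-grading with
plus part `A_0(L_a) ⊕ A_1(L_a)` and minus part `A_l(L_a)`. -/
structure IsLeftAxis (l : F) (a : A) : Prop where
  l_ne_zero : l ≠ 0
  l_ne_one : l ≠ 1
  idem : a * a = a
  prim : leftEig F A a 1 = Submodule.span F {a}
  cube : ∀ v : A, a * (a * (a * v)) - a * (a * v) - l • (a * (a * v)) + l • (a * v) = 0
  decomp : leftEig F A a 0 ⊔ leftEig F A a 1 ⊔ leftEig F A a l = ⊤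
  fusePP : ∀ x ∈ leftEig F A a 0 ⊔ leftEig F A a 1, ∀ y ∈ leftEig F A a 0 ⊔ leftEig F A a 1,
      x * y ∈ leftEig F A a 0 ⊔ leftEig F A a 1
  fusePM : ∀ x ∈ leftEig F A a 0 ⊔ leftEig F A a 1, ∀ y ∈ leftEig F A a l,
      x * y ∈ leftEig F A a l
  fuseMP : ∀ x ∈ leftEig F A a l, ∀ y ∈ leftEig F A a 0 ⊔ leftEig F A a 1,
      x * y ∈ leftEig F A a l
  fuseMM : ∀ x ∈ leftEig F A a l, ∀ y ∈ leftEig F A a l,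
      x * y ∈ leftEig F A a 0 ⊔ leftEig F A a 1

/-- `a` is a right axis of type `d`: the symmetric notion with `R_a` in place of `L_a`. -/
structure IsRightAxis (d : F) (a : A) : Prop where
  d_ne_zero : d ≠ 0
  d_ne_one : d ≠ 1
  idem : a * a = a
  prim : rightEig F A a 1 = Submodule.span F {a}
  cube : ∀ v : A, v * a * a * a - v * a * a - d • (v * a * a) + d • (v * a) = 0
  decomp : rightEig F A a 0 ⊔ rightEig F A a 1 ⊔ rightEig F A a d = ⊤
  fusePP : ∀ x ∈ rightEig F A a 0 ⊔ rightEig F A a 1, ∀ y ∈ rightEig F A a 0 ⊔ rightEig F A a 1,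
      x * y ∈ rightEig F A a 0 ⊔ rightEig F A a 1
  fusePM : ∀ x ∈ rightEig F A a 0 ⊔ rightEig F A a 1, ∀ y ∈ rightEig F A a d,
      x * y ∈ rightEig F A a d
  fuseMP : ∀ x ∈ rightEig F A a d, ∀ y ∈ rightEig F A a 0 ⊔ rightEig F A a 1,
      x * y ∈ rightEig F A a d
  fuseMM : ∀ x ∈ rightEig F A a d, ∀ y ∈ rightEig F A a d,
      x * y ∈ rightEig F A a 0 ⊔ rightEig F A a 1

/-- `a` is a (two-sided) axis of type `(l, d)`. -/
structure IsAxis (l d : F) (a : A) : Prop where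
  toLeft : IsLeftAxis F A l a
  toRight : IsRightAxis F A d a
  comm : ∀ v : A, a * (v * a) = (a * v) * a

/-- `a` is an axis of Jordan type `(l, d)`: an axis of type `(l, d)` with
`A_{l,0}(a) = A_{0,d}(a) = 0`, so that `A = F·a ⊕ A_{0,0}(a) ⊕ A_{l,d}(a)`. -/
structure IsJordanAxis (l d : F) (a : A) extends IsAxis F A l d a : Prop where
  j_left : eig2 F A a l 0 = ⊥
  j_right : eig2 F A a 0 d = ⊥

section EigenvectorSums

variable {K V : Type*} [Field K] [AddCommGroup V] [Module K V]

/-- Eigenvectors for the distinct eigenvalues `0`, `1`, `l` that sum to zero all vanish. -/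
theorem eigenvectors_eq_zero_of_add_eq_zero (T : Module.End K V) {l : K} (h0 : l ≠ 0) (h1 : l ≠ 1)
    {x y z : V} (hx : T x = (0 : K) • x) (hy : T y = (1 : K) • y) (hz : T z = l • z)
    (h : x + y + z = 0) : x = 0 ∧ y = 0 ∧ z = 0 := by
  have e1 : y + l • z = 0 := by simpa [hx, hy, hz] using congrArg T h
  have e2 : y + (l * l) • z = 0 := by simpa [hy, hz, smul_smul] using congrArg T e1
  have e3 : (l * (l - 1)) • z = 0 := by
    linear_combination (norm := module) e2 - e1
  have hz0 : z = 0 :=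
    (smul_eq_zero.mp e3).resolve_left (mul_ne_zero h0 (sub_ne_zero.mpr h1))
  subst hz0
  have hy0 : y = 0 := by simpa using e1
  subst hy0
  exact ⟨by simpa using h, rfl, rfl⟩

end EigenvectorSums

section LeftAxes

variable {F : Type*} [Field F]
variable {A : Type*} [NonUnitalNonAssocRing A] [Module F A] [SMulCommClass F A A]

theorem mem_leftEig {a v : A} {l : F} : v ∈ leftEig F A a l ↔ a * v = l • v := Iff.rfl

theorem IsLeftAxis.eq_zero_of_add_eq_zero {l : F} {a x y z : A} (ha : IsLeftAxis F A l a)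
    (hx : x ∈ leftEig F A a 0) (hy : y ∈ leftEig F A a 1) (hz : z ∈ leftEig F A a l)
    (h : x + y + z = 0) : x = 0 ∧ y = 0 ∧ z = 0 :=
  eigenvectors_eq_zero_of_add_eq_zero (LinearMap.mulLeft F a) ha.l_ne_zero ha.l_ne_one hx hy hz h

theorem IsLeftAxis.plus_minus_eq_zero {l : F} {a u v : A} (ha : IsLeftAxis F A l a)
    (hu : u ∈ leftEig F A a 0 ⊔ leftEig F A a 1) (hv : v ∈ leftEig F A a l)
    (h : u + v = 0) : u = 0 ∧ v = 0 := by
  obtain ⟨x, hx, y, hy, rfl⟩ := Submodule.mem_sup.mp hu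
  obtain ⟨rfl, rfl, rfl⟩ := ha.eq_zero_of_add_eq_zero hx hy hv h
  simp

end LeftAxes

section RightAxes

variable {F : Type*} [Field F]
variable {A : Type*} [NonUnitalNonAssocRing A] [Module F A] [IsScalarTower F A A]

theorem mem_rightEig {a v : A} {l : F} : v ∈ rightEig F A a l ↔ v * a = l • v := Iff.rfl

theorem IsRightAxis.eq_zero_of_add_eq_zero {d : F} {a x y z : A} (ha : IsRightAxis F A d a)
    (hx : x ∈ rightEig F A a 0) (hy : y ∈ rightEig F A a 1) (hz : z ∈ rightEig F A a d)
    (h : x + y + z = 0) : x = 0 ∧ y = 0 ∧ z = 0 :=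
  eigenvectors_eq_zero_of_add_eq_zero (LinearMap.mulRight F a) ha.d_ne_zero ha.d_ne_one hx hy hz h

theorem IsRightAxis.plus_minus_eq_zero {d : F} {a u v : A} (ha : IsRightAxis F A d a)
    (hu : u ∈ rightEig F A a 0 ⊔ rightEig F A a 1) (hv : v ∈ rightEig F A a d)
    (h : u + v = 0) : u = 0 ∧ v = 0 := by
  obtain ⟨x, hx, y, hy, rfl⟩ := Submodule.mem_sup.mp hu
  obtain ⟨rfl, rfl, rfl⟩ := ha.eq_zero_of_add_eq_zero hx hy hv h
  simp

end RightAxes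

section Axes

variable {F : Type*} [Field F]
variable {A : Type*} [NonUnitalNonAssocRing A] [Module F A]
  [SMulCommClass F A A] [IsScalarTower F A A]

/-- A right eigenvector for an eigenvalue other than `1` is a sum of joint eigenvectors. -/
theorem IsAxis.exists_add_of_mem_rightEig {l d μ : F} {b y : A} (hb : IsAxis F A l d b)
    (hμ : μ ≠ 1) (hy : y ∈ rightEig F A b μ) :
    ∃ u ∈ eig2 F A b 0 μ, ∃ v ∈ eig2 F A b l μ, y = u + v := by
  have hmem : y ∈ leftEig F A b 0 ⊔ leftEig F A b 1 ⊔ leftEig F A b l := by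
    rw [hb.toLeft.decomp]; trivial
  obtain ⟨s, hs, v, hv, rfl⟩ := Submodule.mem_sup.mp hmem
  obtain ⟨u, hu, w, hw, rfl⟩ := Submodule.mem_sup.mp hs
  have key : ∀ {κ : F} {x : A}, x ∈ leftEig F A b κ → x * b - μ • x ∈ leftEig F A b κ := by
    intro κ x hx
    refine Submodule.sub_mem _ ?_ (Submodule.smul_mem _ _ hx)
    rw [mem_leftEig] at hx ⊢
    rw [hb.comm, hx, smul_mul_assoc]
  have hsum : (u * b - μ • u) + (w * b - μ • w) + (v * b - μ • v) = 0 := by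
    have h := mem_rightEig.mp hy
    rw [add_mul, add_mul] at h
    linear_combination (norm := module) h
  obtain ⟨h1, h2, h3⟩ := hb.toLeft.eq_zero_of_add_eq_zero (key hu) (key hw) (key hv) hsum
  have hwb : w * b = w := by
    rw [hb.toLeft.prim] at hw
    obtain ⟨t, rfl⟩ := Submodule.mem_span_singleton.mp hw
    rw [smul_mul_assoc, hb.toLeft.idem]
  have hw0 : w = 0 := by
    rw [hwb] at h2
    have h4 : (1 - μ) • w = 0 := by linear_combination (norm := module) h2
    exact (smul_eq_zero.mp h4).resolve_left (sub_ne_zero.mpr hμ.symm)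
  refine ⟨u, ⟨hu, sub_eq_zero.mp h1⟩, v, ⟨hv, sub_eq_zero.mp h3⟩, ?_⟩
  rw [hw0, add_zero]

theorem IsAxis.exists_joint_decomposition {l d : F} {b : A} (hb : IsAxis F A l d b) (a : A) :
    ∃ w ∈ eig2 F A b 1 1, ∃ x ∈ eig2 F A b 0 0, ∃ p ∈ eig2 F A b 0 d, ∃ q ∈ eig2 F A b l 0,
      ∃ m ∈ eig2 F A b l d, a = w + x + p + q + m := by
  have hmem : a ∈ rightEig F A b 0 ⊔ rightEig F A b 1 ⊔ rightEig F A b d := by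
    rw [hb.toRight.decomp]; trivial
  obtain ⟨s, hs, z, hz, rfl⟩ := Submodule.mem_sup.mp hmem
  obtain ⟨y, hy, w, hw, rfl⟩ := Submodule.mem_sup.mp hs
  obtain ⟨x, hx, q, hq, rfl⟩ := hb.exists_add_of_mem_rightEig zero_ne_one hy
  obtain ⟨p, hp, m, hm, rfl⟩ := hb.exists_add_of_mem_rightEig hb.toRight.d_ne_one hz
  refine ⟨w, ⟨?_, hw⟩, x, hx, p, hp, q, hq, m, hm, by abel⟩
  rw [hb.toLeft.prim, ← hb.toRight.prim]
  exact hw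

theorem IsAxis.joint_eq_zero_of_add_eq_zero {l d : F} {b w x p q m : A} (hb : IsAxis F A l d b)
    (hw : w ∈ eig2 F A b 1 1) (hx : x ∈ eig2 F A b 0 0) (hp : p ∈ eig2 F A b 0 d)
    (hq : q ∈ eig2 F A b l 0) (hm : m ∈ eig2 F A b l d) (h : w + x + p + q + m = 0) :
    w = 0 ∧ x = 0 ∧ p = 0 ∧ q = 0 ∧ m = 0 := by
  have hL : (x + p) + w + (q + m) = 0 := by rw [← h]; abel
  obtain ⟨h1, h2, h3⟩ := hb.toLeft.eq_zero_of_add_eq_zero (add_mem hx.1 hp.1) hw.1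
    (add_mem hq.1 hm.1) hL
  obtain ⟨hx0, hp0⟩ := hb.toRight.plus_minus_eq_zero (Submodule.mem_sup_left hx.2) hp.2 h1
  obtain ⟨hq0, hm0⟩ := hb.toRight.plus_minus_eq_zero (Submodule.mem_sup_left hq.2) hm.2 h3
  exact ⟨h2, hx0, hp0, hq0, hm0⟩

/-- If `a = e + m` with `e` in the plus part and `m` in the minus part of a left axis `b`, and
`c` is a multiple of `m` that is an eigenvector of left multiplication by `a`, then `c` squares
to zero. -/
theorem IsLeftAxis.sq_eq_zero_of_eigenvector {l κ μ : F} {b e m c : A} (hb : IsLeftAxis F A l b)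
    (he : e ∈ leftEig F A b 0 ⊔ leftEig F A b 1) (hm : m ∈ leftEig F A b l) (hc : c = κ • m)
    (hac : (e + m) * c = μ • c) : c * c = 0 := by
  have hcm : c ∈ leftEig F A b l := hc ▸ Submodule.smul_mem _ _ hm
  have hmc : m * c = 0 := by
    refine (hb.plus_minus_eq_zero (hb.fuseMM m hm c hcm)
      (sub_mem (hb.fusePM e he c hcm) (Submodule.smul_mem _ μ hcm)) ?_).1
    rw [← hac, add_mul]
    abel
  nth_rewrite 1 [hc]
  rw [smul_mul_assoc, hmc, smul_zero]

/-- If `w + p + q` acts on `d • p - l • q` from the left and from the right by nonzero scalars,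
where `w`, `p`, `q` are joint eigenvectors of an axis for `(1, 1)`, `(0, d)`, `(l, 0)`, then
`p = q = 0`. -/
theorem IsAxis.eq_zero_of_eigenvector {l d μ ν : F} {b w p q : A} (hb : IsAxis F A l d b)
    (hw : w ∈ eig2 F A b 1 1) (hp : p ∈ eig2 F A b 0 d) (hq : q ∈ eig2 F A b l 0)
    (hμ : μ ≠ 0) (hν : ν ≠ 0)
    (hL : (w + p + q) * (d • p - l • q) = μ • (d • p - l • q))
    (hR : (d • p - l • q) * (w + p + q) = ν • (d • p - l • q)) : p = 0 ∧ q = 0 := by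
  obtain ⟨t, rfl⟩ : ∃ t : F, t • b = w := by
    have h := hw.1
    rw [hb.toLeft.prim] at h
    exact Submodule.mem_span_singleton.mp h
  have hbp : b * p = 0 := by simpa using mem_leftEig.mp hp.1
  have hpb : p * b = d • p := hp.2
  have hbq : b * q = l • q := hq.1
  have hqb : q * b = 0 := by simpa using mem_rightEig.mp hq.2
  have hpL := Submodule.mem_sup_left (T := leftEig F A b 1) hp.1
  have hqR := Submodule.mem_sup_left (T := rightEig F A b 1) hq.2
  have hsqL : d • (p * p) - l • (q * q) ∈ leftEig F A b 0 ⊔ leftEig F A b 1 :=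
    sub_mem (Submodule.smul_mem _ _ (hb.toLeft.fusePP p hpL p hpL))
      (Submodule.smul_mem _ _ (hb.toLeft.fuseMM q hq.1 q hq.1))
  have hsqR : d • (p * p) - l • (q * q) ∈ rightEig F A b 0 ⊔ rightEig F A b 1 :=
    sub_mem (Submodule.smul_mem _ _ (hb.toRight.fuseMM p hp.2 p hp.2))
      (Submodule.smul_mem _ _ (hb.toRight.fusePP q hqR q hqR))
  have hqpL := hb.toLeft.fuseMP q hq.1 p hpL
  have hpqL := hb.toLeft.fusePM p hpL q hq.1
  have hqpR := hb.toRight.fusePM q hqR p hp.2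
  have hpqR := hb.toRight.fuseMP p hp.2 q hqR
  simp only [add_mul, mul_sub, smul_mul_assoc, mul_smul_comm, hbp, hbq, smul_zero] at hL
  simp only [mul_add, sub_mul, smul_mul_assoc, mul_smul_comm, hpb, hqb, smul_zero] at hR
  have hLplus : d • (p * p) - l • (q * q) - (μ * d) • p = 0 := by
    refine (hb.toLeft.plus_minus_eq_zero (sub_mem hsqL (Submodule.smul_mem _ _ hpL))
      (v := d • (q * p) - l • (p * q) - (t * l * l - μ * l) • q)
      (sub_mem (sub_mem (Submodule.smul_mem _ _ hqpL) (Submodule.smul_mem _ _ hpqL))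
        (Submodule.smul_mem _ _ hq.1)) ?_).1
    linear_combination (norm := module) hL
  have hRplus : d • (p * p) - l • (q * q) + (ν * l) • q = 0 := by
    refine (hb.toRight.plus_minus_eq_zero (add_mem hsqR (Submodule.smul_mem _ _ hqR))
      (v := d • (p * q) - l • (q * p) + (t * d * d - ν * d) • p)
      (add_mem (sub_mem (Submodule.smul_mem _ _ hpqR) (Submodule.smul_mem _ _ hqpR))
        (Submodule.smul_mem _ _ hp.2)) ?_).1
    linear_combination (norm := module) hR
  have hp0 := (hb.toRight.plus_minus_eq_zero hsqR
    (neg_mem (Submodule.smul_mem _ (μ * d) hp.2)) (by rw [← hLplus]; abel)).2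
  have hq0 := (hb.toLeft.plus_minus_eq_zero hsqL (Submodule.smul_mem _ (ν * l) hq.1) hRplus).2
  exact ⟨(smul_eq_zero.mp (neg_eq_zero.mp hp0)).resolve_left
      (mul_ne_zero hμ hb.toRight.d_ne_zero),
    (smul_eq_zero.mp hq0).resolve_left (mul_ne_zero hν hb.toLeft.l_ne_zero)⟩

end Axes

/-- If `a` is an axis of Jordan type `(l, d)` with `l ≠ d` and `b` is an axis of
type `(l', d')`, with `b = αb • a + b₀ + b_{l,d}`, `b₀ ∈ A_{0,0}(a)`, `b_{l,d} ∈ A_{l,d}(a)`,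
then `b_{l,d} * b_{l,d} = 0`. -/
theorem jordan_axis_minus_component_sq_eq_zero (hchar : (2 : F) ≠ 0) (l d l' d' : F) (a b : A)
    (ha : IsJordanAxis F A l d a) (hld : l ≠ d) (hb : IsAxis F A l' d' b)
    (αb : F) (b0 bld : A) (hb0 : b0 ∈ eig2 F A a 0 0) (hbld : bld ∈ eig2 F A a l d)
    (hdec : b = αb • a + b0 + bld) :
    bld * bld = 0 := by
  have hl := ha.toLeft.l_ne_zero
  have hd := ha.toRight.d_ne_zero
  have hl' := hb.toLeft.l_ne_zero
  have hd' := hb.toRight.d_ne_zero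
  have hld0 : l - d ≠ 0 := sub_ne_zero.mpr hld
  have hac : a * bld = l • bld := hbld.1
  have hca : bld * a = d • bld := hbld.2
  have hab : a * b = αb • a + l • bld := by
    have h : a * b0 = 0 := by simpa using mem_leftEig.mp hb0.1
    rw [hdec, mul_add, mul_add, mul_smul_comm, ha.toLeft.idem, h, hac, add_zero]
  have hba : b * a = αb • a + d • bld := by
    have h : b0 * a = 0 := by simpa using mem_rightEig.mp hb0.2
    rw [hdec, add_mul, add_mul, smul_mul_assoc, ha.toLeft.idem, h, hca, add_zero]
  obtain ⟨w, hw, x, hx, p, hp, q, hq, m, hm, hsum⟩ := hb.exists_joint_decomposition a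
  have hab' : a * b = w + d' • p + d' • m := by
    rw [hsum]
    simp only [add_mul, mem_rightEig.mp hw.2, mem_rightEig.mp hx.2, mem_rightEig.mp hp.2,
      mem_rightEig.mp hq.2, mem_rightEig.mp hm.2, one_smul, zero_smul, add_zero]
  have hba' : b * a = w + l' • q + l' • m := by
    rw [hsum]
    simp only [mul_add, mem_leftEig.mp hw.1, mem_leftEig.mp hx.1, mem_leftEig.mp hp.1,
      mem_leftEig.mp hq.1, mem_leftEig.mp hm.1, one_smul, zero_smul, add_zero]
  rw [hab] at hab'
  rw [hba] at hba'
  have hc : (l - d) • bld = d' • p - l' • q + (d' - l') • m := by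
    linear_combination (norm := module) hab' - hba'
  have hcomp : ((d - l) * (1 - αb)) • w + (-((d - l) * αb)) • x + (d * d' - (d - l) * αb) • p
      + (-(l * l') - (d - l) * αb) • q + (d * d' - l * l' - (d - l) * αb) • m = 0 := by
    linear_combination (norm := module) l • hba' - d • hab' + ((d - l) * αb) • hsum
  obtain ⟨-, hx0, hp0, hq0, hm0⟩ := hb.joint_eq_zero_of_add_eq_zero
    (Submodule.smul_mem _ _ hw) (Submodule.smul_mem _ _ hx) (Submodule.smul_mem _ _ hp)
    (Submodule.smul_mem _ _ hq) (Submodule.smul_mem _ _ hm) hcomp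
  rcases smul_eq_zero.mp hm0 with hs | rfl
  · have hp1 : (l * l') • p = 0 := by
      rw [← hp0]; congr 1; linear_combination -hs
    have hq1 : (-(d * d')) • q = 0 := by
      rw [← hq0]; congr 1; linear_combination -hs
    obtain rfl := (smul_eq_zero.mp hp1).resolve_left (mul_ne_zero hl hl')
    obtain rfl := (smul_eq_zero.mp hq1).resolve_left (neg_ne_zero.mpr (mul_ne_zero hd hd'))
    have hcm : bld = ((l - d)⁻¹ * (d' - l')) • m := by
      rw [mul_smul, eq_inv_smul_iff₀ hld0, hc]
      simp
    refine hb.toLeft.sq_eq_zero_of_eigenvector (e := w + x) (μ := l)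
      (add_mem (Submodule.mem_sup_right hw.1) (Submodule.mem_sup_left hx.1)) hm.1 hcm ?_
    rw [← hac, hsum]
    simp
  · suffices h : p = 0 ∧ q = 0 by
      have h0 : (l - d) • bld = 0 := by rw [hc, h.1, h.2]; simp
      rw [(smul_eq_zero.mp h0).resolve_left hld0, mul_zero]
    rcases smul_eq_zero.mp hx0 with hs | rfl
    · refine ⟨(smul_eq_zero.mp hp0).resolve_left fun h => mul_ne_zero hd hd' ?_,
        (smul_eq_zero.mp hq0).resolve_left fun h => mul_ne_zero hl hl' ?_⟩
      · linear_combination h - hs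
      · linear_combination hs - h
    · have hsum' : w + p + q = a := by rw [hsum]; simp
      have hc' : d' • p - l' • q = (l - d) • bld := by rw [hc]; simp
      refine hb.eq_zero_of_eigenvector hw hp hq hl hd ?_ ?_
      · rw [hsum', hc', mul_smul_comm, hac, smul_comm]
      · rw [hsum', hc', smul_mul_assoc, hca, smul_comm]
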